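/- Let p ∈ (0,1) and let {X_n, n≥1} be a φ-mixing sequence of random variables with common marginal distribution function F satisfying F(ξ_p) = p, and let F_n be the empirical distribution function. Fix y ∈ ℝ and set z = |F(y) − F(ξ_p)|. Then for any γ > 0, any 0 < β < 1 with m = ⌈n^β⌉, and any n ≥ 2, P(|(F_n(y) − F(y)) − (F_n(ξ_p) − p)| > γ) ≤ 2e C_1 exp{−n γ² / (2 C_2 (2 z + n^β γ))}, where C_1 = exp{2e n^{1−β} φ(m)} and C_2 = 4[1 + 4 Σ_{i=1}^{2m} φ^{1/2}(i)]. -/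

import Mathlib

open MeasureTheory Filter Set

/-- The σ-algebra generated by the random variables `X i` for `i ∈ S`. -/
noncomputable def sigmaGen {Ω : Type*} (X : ℕ → Ω → ℝ) (S : Set ℕ) : MeasurableSpace Ω :=
  ⨆ i ∈ S, MeasurableSpace.comap (X i) inferInstance

/-- The φ-mixing coefficients of the sequence `X` with respect to the measure `μ`:
`φ(n) = sup_{k ≥ 1} sup { |P(B|A) - P(B)| : A ∈ σ(X_i, 1 ≤ i ≤ k), P(A) > 0,
B ∈ σ(X_i, i ≥ k + n) }`. -/
noncomputable def phiCoef {Ω : Type*} [MeasurableSpace Ω] (X : ℕ → Ω → ℝ)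
    (μ : Measure Ω) (n : ℕ) : ℝ :=
  sSup {r : ℝ | ∃ k : ℕ, 1 ≤ k ∧ ∃ A B : Set Ω,
    MeasurableSet[sigmaGen X {i | 1 ≤ i ∧ i ≤ k}] A ∧
    MeasurableSet[sigmaGen X {i | k + n ≤ i}] B ∧
    0 < μ A ∧
    r = |(μ (A ∩ B)).toReal / (μ A).toReal - (μ B).toReal|}

/-- The empirical distribution function `F_n(x) = n⁻¹ ∑_{i=1}^n I(X_i ≤ x)`. -/
noncomputable def empDF {Ω : Type*} (X : ℕ → Ω → ℝ) (n : ℕ) (ω : Ω) (x : ℝ) : ℝ :=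
  (n : ℝ)⁻¹ * ∑ i ∈ Finset.Icc 1 n, (if X i ω ≤ x then (1 : ℝ) else 0)

/-- The `p`-th quantile `F⁻¹(p) = inf {x : F(x) ≥ p}` of a distribution function `F`. -/
noncomputable def quantile (F : ℝ → ℝ) (p : ℝ) : ℝ :=
  sInf {x : ℝ | p ≤ F x}

/-- The sample `p`-th quantile `ξ_{p,n} = F_n⁻¹(p) = inf {x : F_n(x) ≥ p}`. -/
noncomputable def sampleQuantile {Ω : Type*} (X : ℕ → Ω → ℝ) (n : ℕ) (ω : Ω) (p : ℝ) : ℝ :=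
  sInf {x : ℝ | p ≤ empDF X n ω x}

lemma sigmaGen_mono {Ω : Type*} (X : ℕ → Ω → ℝ) {S T : Set ℕ} (h : S ⊆ T) :
    sigmaGen X S ≤ sigmaGen X T :=
  biSup_mono h

lemma comap_le_sigmaGen {Ω : Type*} (X : ℕ → Ω → ℝ) {S : Set ℕ} {i : ℕ} (hi : i ∈ S) :
    MeasurableSpace.comap (X i) inferInstance ≤ sigmaGen X S :=
  le_biSup (fun i => MeasurableSpace.comap (X i) inferInstance) hi

lemma sigmaGen_le {Ω : Type*} [mΩ : MeasurableSpace Ω] {X : ℕ → Ω → ℝ}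
    (hX : ∀ i, Measurable (X i)) (S : Set ℕ) : sigmaGen X S ≤ mΩ :=
  iSup₂_le fun i _ => (hX i).comap_le

lemma phiCoef_nonneg {Ω : Type*} [MeasurableSpace Ω] {X : ℕ → Ω → ℝ} {μ : Measure Ω} (n : ℕ) :
    0 ≤ phiCoef X μ n := by
  apply Real.sSup_nonneg
  rintro r ⟨k, -, A, B, -, -, -, rfl⟩
  exact abs_nonneg _

/-- The sum of the `j`-th block of `m` consecutive terms of `Y`, starting at index `1`. -/
def blockSum {Ω : Type*} (Y : ℕ → Ω → ℝ) (m j : ℕ) (ω : Ω) : ℝ :=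
  ∑ l ∈ Finset.range m, Y (j * m + 1 + l) ω

lemma sum_range_eq_blockSum {Ω : Type*} (Y : ℕ → Ω → ℝ) (m r : ℕ) (ω : Ω) :
    ∑ l ∈ Finset.range (2 * r * m), Y (1 + l) ω =
      ∑ j ∈ Finset.range r, blockSum Y m (2 * j) ω +
        ∑ j ∈ Finset.range r, blockSum Y m (2 * j + 1) ω := by
  induction r with
  | zero => simp
  | succ r ih =>
    have h : 2 * (r + 1) * m = 2 * r * m + m + m := by ring
    rw [h, Finset.sum_range_add, Finset.sum_range_add, ih, Finset.sum_range_succ,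
      Finset.sum_range_succ]
    have h1 : ∑ l ∈ Finset.range m, Y (1 + (2 * r * m + l)) ω = blockSum Y m (2 * r) ω :=
      Finset.sum_congr rfl fun l _ => by congr 1; ring
    have h2 : ∑ l ∈ Finset.range m, Y (1 + (2 * r * m + m + l)) ω = blockSum Y m (2 * r + 1) ω :=
      Finset.sum_congr rfl fun l _ => by congr 1; ring
    rw [h1, h2]
    ring

lemma measurable_blockSum {Ω : Type*} {X Y : ℕ → Ω → ℝ}
    (hY : ∀ i, Measurable[MeasurableSpace.comap (X i) inferInstance] (Y i)) (m j : ℕ) :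
    Measurable[sigmaGen X (Ioc (j * m) (j * m + m))] (blockSum Y m j) := by
  refine Finset.measurable_fun_sum _ fun l hl => (hY _).mono (comap_le_sigmaGen X ?_) le_rfl
  have := Finset.mem_range.1 hl
  constructor <;> omega

lemma abs_blockSum_le {Ω : Type*} {Y : ℕ → Ω → ℝ} (hY1 : ∀ i ω, |Y i ω| ≤ 1) (m j : ℕ) (ω : Ω) :
    |blockSum Y m j ω| ≤ m :=
  (Finset.abs_sum_le_sum_abs _ _).trans
    ((Finset.sum_le_sum fun _ _ => hY1 _ ω).trans_eq (by simp))

section Mixing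

variable {Ω : Type*} [mΩ : MeasurableSpace Ω] {X : ℕ → Ω → ℝ} {μ : Measure Ω}
  [IsProbabilityMeasure μ]

lemma abs_cond_sub_le_one (A B : Set Ω) :
    |(μ (A ∩ B)).toReal / (μ A).toReal - (μ B).toReal| ≤ 1 := by
  have h1 : (μ (A ∩ B)).toReal ≤ (μ A).toReal := measureReal_mono inter_subset_left
  have h2 : (μ (A ∩ B)).toReal / (μ A).toReal ≤ 1 := div_le_one_of_le₀ h1 ENNReal.toReal_nonneg
  have h3 : 0 ≤ (μ (A ∩ B)).toReal / (μ A).toReal := by positivity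
  have h4 : (μ B).toReal ≤ 1 := measureReal_le_one
  have h5 : 0 ≤ (μ B).toReal := ENNReal.toReal_nonneg
  rw [abs_le]
  constructor <;> linarith

lemma phiCoef_le_one (n : ℕ) : phiCoef X μ n ≤ 1 := by
  apply Real.sSup_le _ zero_le_one
  rintro r ⟨k, -, A, B, -, -, -, rfl⟩
  exact abs_cond_sub_le_one A B

lemma phiCoef_le_sqrt (n : ℕ) : phiCoef X μ n ≤ Real.sqrt (phiCoef X μ n) :=
  Real.le_sqrt_of_sq_le (pow_le_of_le_one (phiCoef_nonneg n) (phiCoef_le_one n) two_ne_zero)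

lemma measure_inter_le_phiCoef {k n : ℕ} (hk : 1 ≤ k) {A B : Set Ω}
    (hA : MeasurableSet[sigmaGen X {i | 1 ≤ i ∧ i ≤ k}] A)
    (hB : MeasurableSet[sigmaGen X {i | k + n ≤ i}] B) :
    μ (A ∩ B) ≤ μ A * (μ B + ENNReal.ofReal (phiCoef X μ n)) := by
  rcases eq_or_ne (μ A) 0 with h0 | h0
  · simp [measure_mono_null inter_subset_left h0]
  have hpos : 0 < (μ A).toReal := ENNReal.toReal_pos h0 (measure_ne_top _ _)
  have hle : |(μ (A ∩ B)).toReal / (μ A).toReal - (μ B).toReal| ≤ phiCoef X μ n := by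
    refine le_csSup ⟨1, ?_⟩ ⟨k, hk, A, B, hA, hB, pos_iff_ne_zero.2 h0, rfl⟩
    rintro r ⟨k, -, A, B, -, -, -, rfl⟩
    exact abs_cond_sub_le_one A B
  have h := (abs_le.1 hle).2
  rw [sub_le_iff_le_add, div_le_iff₀ hpos] at h
  rw [← ENNReal.ofReal_toReal (measure_ne_top μ (A ∩ B)),
    ← ENNReal.ofReal_toReal (measure_ne_top μ A), ← ENNReal.ofReal_toReal (measure_ne_top μ B),
    ← ENNReal.ofReal_add ENNReal.toReal_nonneg (phiCoef_nonneg n),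
    ← ENNReal.ofReal_mul ENNReal.toReal_nonneg]
  exact ENNReal.ofReal_le_ofReal (by linarith)

lemma setLIntegral_le_phiCoef (hX : ∀ i, Measurable (X i)) {k n : ℕ} (hk : 1 ≤ k)
    {f : Ω → ENNReal} {B : Set Ω}
    (hf : Measurable[sigmaGen X {i | 1 ≤ i ∧ i ≤ k}] f)
    (hB : MeasurableSet[sigmaGen X {i | k + n ≤ i}] B) :
    ∫⁻ ω in B, f ω ∂μ ≤ (μ B + ENNReal.ofReal (phiCoef X μ n)) * ∫⁻ ω, f ω ∂μ := by
  have hm := sigmaGen_le hX {i | 1 ≤ i ∧ i ≤ k}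
  rw [← lintegral_trim hm hf, ← lintegral_trim hm hf, ← smul_eq_mul, ← lintegral_smul_measure]
  refine lintegral_mono' (Measure.le_iff.2 fun A hA => ?_) le_rfl
  rw [Measure.smul_apply, trim_measurableSet_eq hm hA, trim_measurableSet_eq hm hA,
    Measure.restrict_apply (hm A hA), smul_eq_mul, mul_comm]
  exact measure_inter_le_phiCoef hk hA hB

lemma lintegral_mul_le_phiCoef (hX : ∀ i, Measurable (X i)) {k n : ℕ} (hk : 1 ≤ k)
    {f : Ω → ENNReal} {g : Ω → ℝ} {M : ℝ}
    (hf : Measurable[sigmaGen X {i | 1 ≤ i ∧ i ≤ k}] f) (hfi : ∫⁻ ω, f ω ∂μ ≠ ⊤)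
    (hg : Measurable[sigmaGen X {i | k + n ≤ i}] g) (hg0 : ∀ ω, 0 ≤ g ω) (hgM : ∀ ω, g ω ≤ M) :
    ∫⁻ ω, f ω * ENNReal.ofReal (g ω) ∂μ ≤
      (∫⁻ ω, f ω ∂μ) *
        (∫⁻ ω, ENNReal.ofReal (g ω) ∂μ + ENNReal.ofReal (phiCoef X μ n) * ENNReal.ofReal M) := by
  have hfm : Measurable f := hf.mono (sigmaGen_le hX _) le_rfl
  have hgm : Measurable g := hg.mono (sigmaGen_le hX _) le_rfl
  have hlayer (ν : Measure Ω) :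
      ∫⁻ ω, ENNReal.ofReal (g ω) ∂ν = ∫⁻ t in Ioi 0, ν {ω | t < g ω} :=
    lintegral_eq_lintegral_meas_lt ν (ae_of_all _ hg0) hgm.aemeasurable
  have hdens : ∫⁻ ω, f ω * ENNReal.ofReal (g ω) ∂μ =
      ∫⁻ ω, ENNReal.ofReal (g ω) ∂(μ.withDensity f) :=
    (lintegral_withDensity_eq_lintegral_mul μ hfm hgm.ennreal_ofReal).symm
  have hind : ENNReal.ofReal (phiCoef X μ n) * ENNReal.ofReal M =
      ∫⁻ t in Ioi (0 : ℝ), (Iio M).indicator (fun _ => ENNReal.ofReal (phiCoef X μ n)) t := by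
    rw [lintegral_indicator measurableSet_Iio, Measure.restrict_restrict measurableSet_Iio,
      Iio_inter_Ioi]
    simp
  rw [hdens, hlayer, hlayer, hind,
    ← lintegral_add_right _ (measurable_const.indicator measurableSet_Iio),
    ← lintegral_const_mul' _ _ hfi]
  refine lintegral_mono fun t => ?_
  have hset : MeasurableSet[sigmaGen X {i | k + n ≤ i}] {ω | t < g ω} := hg measurableSet_Ioi
  simp only
  rcases lt_or_ge t M with htM | htM
  · rw [withDensity_apply _ (measurableSet_lt measurable_const hgm), indicator_of_mem (mem_Iio.2 htM), mul_comm]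
    exact setLIntegral_le_phiCoef hX hk hf hset
  · have : {ω | t < g ω} = ∅ := eq_empty_of_forall_notMem fun ω hω =>
      (((hgM ω).trans htM).trans_lt hω).false
    simp [this]

lemma integral_mul_le_phiCoef (hX : ∀ i, Measurable (X i)) {k n : ℕ} (hk : 1 ≤ k)
    {f g : Ω → ℝ} {M : ℝ}
    (hf : Measurable[sigmaGen X {i | 1 ≤ i ∧ i ≤ k}] f) (hf0 : ∀ ω, 0 ≤ f ω)
    (hfi : Integrable f μ)
    (hg : Measurable[sigmaGen X {i | k + n ≤ i}] g) (hg0 : ∀ ω, 0 ≤ g ω) (hgM : ∀ ω, g ω ≤ M) :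
    ∫ ω, f ω * g ω ∂μ ≤ (∫ ω, f ω ∂μ) * (∫ ω, g ω ∂μ + phiCoef X μ n * M) := by
  have hgm : Measurable g := hg.mono (sigmaGen_le hX _) le_rfl
  have hgb : ∀ᵐ ω ∂μ, ‖g ω‖ ≤ M :=
    ae_of_all _ fun ω => by rw [Real.norm_of_nonneg (hg0 ω)]; exact hgM ω
  have hgi : Integrable g μ := Integrable.of_bound hgm.aestronglyMeasurable M hgb
  have hfgi : Integrable (fun ω => f ω * g ω) μ := hfi.mul_bdd hgm.aestronglyMeasurable hgb
  have hM : 0 ≤ M := by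
    obtain ⟨ω⟩ := nonempty_of_isProbabilityMeasure μ
    exact (hg0 ω).trans (hgM ω)
  have hF := ofReal_integral_eq_lintegral_ofReal hfi (ae_of_all _ hf0)
  have hG := ofReal_integral_eq_lintegral_ofReal hgi (ae_of_all _ hg0)
  have hFG := ofReal_integral_eq_lintegral_ofReal hfgi
    (ae_of_all _ fun ω => mul_nonneg (hf0 ω) (hg0 ω))
  have hφ := phiCoef_nonneg (X := X) (μ := μ) n
  have hIf : 0 ≤ ∫ ω, f ω ∂μ := integral_nonneg hf0
  have hIg : 0 ≤ ∫ ω, g ω ∂μ := integral_nonneg hg0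
  have h := lintegral_mul_le_phiCoef (μ := μ) hX hk hf.ennreal_ofReal
    (by rw [← hF]; exact ENNReal.ofReal_ne_top) hg hg0 hgM
  simp only [← ENNReal.ofReal_mul (hf0 _)] at h
  rw [← hF, ← hG, ← hFG, ← ENNReal.ofReal_mul hφ, ← ENNReal.ofReal_add hIg (by positivity),
    ← ENNReal.ofReal_mul hIf] at h
  exact (ENNReal.ofReal_le_ofReal_iff (by positivity)).1 h

lemma integral_prod_le_phiCoef (hX : ∀ i, Measurable (X i)) {m c : ℕ} (hm : 1 ≤ m)
    {g : ℕ → Ω → ℝ} {M a : ℝ}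
    (hg : ∀ j, Measurable[sigmaGen X (Ioc (2 * j * m + c) (2 * j * m + c + m))] (g j))
    (hg0 : ∀ j ω, 0 ≤ g j ω) (hgM : ∀ j ω, g j ω ≤ M) (hga : ∀ j, ∫ ω, g j ω ∂μ ≤ a) (q : ℕ) :
    ∫ ω, ∏ j ∈ Finset.range (q + 1), g j ω ∂μ ≤ a * (a + phiCoef X μ m * M) ^ q := by
  have ha : 0 ≤ a := (integral_nonneg (hg0 0)).trans (hga 0)
  have hM : 0 ≤ M := by
    obtain ⟨ω⟩ := nonempty_of_isProbabilityMeasure μ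
    exact (hg0 0 ω).trans (hgM 0 ω)
  have hφ := phiCoef_nonneg (X := X) (μ := μ) m
  induction q with
  | zero => simpa using hga 0
  | succ q ih =>
    simp only [Finset.prod_range_succ _ (q + 1)]
    have hprod : Measurable[sigmaGen X {i | 1 ≤ i ∧ i ≤ 2 * q * m + c + m}]
        (fun ω => ∏ j ∈ Finset.range (q + 1), g j ω) := by
      refine Finset.measurable_fun_prod _ fun j hj => (hg j).mono (sigmaGen_mono X ?_) le_rfl
      rintro i ⟨h1, h2⟩
      have : j * m ≤ q * m := Nat.mul_le_mul_right m (Nat.lt_succ_iff.1 (Finset.mem_range.1 hj))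
      constructor
      · omega
      · rw [mul_assoc] at h2 ⊢
        omega
    have hnext : Measurable[sigmaGen X {i | 2 * q * m + c + m + m ≤ i}] (g (q + 1)) := by
      refine (hg (q + 1)).mono (sigmaGen_mono X ?_) le_rfl
      rintro i ⟨h1, -⟩
      have : 2 * (q + 1) * m = 2 * q * m + m + m := by ring
      simp only [mem_ofPred_eq]
      omega
    have hprod0 : ∀ ω, 0 ≤ ∏ j ∈ Finset.range (q + 1), g j ω := fun ω =>
      Finset.prod_nonneg fun j _ => hg0 j ω
    have hint : Integrable (fun ω => ∏ j ∈ Finset.range (q + 1), g j ω) μ := by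
      refine Integrable.of_bound
        (hprod.mono (sigmaGen_le hX _) le_rfl).aestronglyMeasurable (M ^ (q + 1))
        (ae_of_all _ fun ω => ?_)
      rw [Real.norm_of_nonneg (hprod0 ω)]
      exact (Finset.prod_le_prod (fun j _ => hg0 j ω) fun j _ => hgM j ω).trans_eq (by simp)
    refine (integral_mul_le_phiCoef hX (by omega) hprod hprod0 hint hnext
      (hg0 _) (hgM _)).trans ?_
    rw [pow_succ, ← mul_assoc]
    have := integral_nonneg (μ := μ) (f := g (q + 1)) (hg0 (q + 1))
    gcongr
    exact hga _

lemma integrable_of_abs_le {f : Ω → ℝ} (hf : Measurable f) {c : ℝ} (hc : ∀ ω, |f ω| ≤ c) :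
    Integrable f μ :=
  Integrable.of_bound hf.aestronglyMeasurable c (ae_of_all _ hc)

lemma integral_sq_sum_le {Y : ℕ → Ω → ℝ} {z C : ℝ} {c : ℕ → ℝ} {N : ℕ}
    (hY : ∀ i, Measurable (Y i)) (hY1 : ∀ i ω, |Y i ω| ≤ 1) (hz : 0 ≤ z)
    (hvar : ∀ i, ∫ ω, Y i ω ^ 2 ∂μ ≤ z)
    (hcov : ∀ i j, i < j → ∫ ω, Y i ω * Y j ω ∂μ ≤ z * c (j - i))
    (hC : ∀ m ≤ N, ∑ i ∈ Finset.Icc 1 m, c i ≤ C) (s : ℕ) {m : ℕ} (hm : m ≤ N) :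
    ∫ ω, (∑ l ∈ Finset.range m, Y (s + l) ω) ^ 2 ∂μ ≤ m * (z * (1 + 2 * C)) := by
  induction m with
  | zero => simp
  | succ m ih =>
    have hprod : ∀ i j, Integrable (fun ω => Y i ω * Y j ω) μ := fun i j =>
      integrable_of_abs_le ((hY i).mul (hY j)) (c := 1) fun ω => by
        rw [abs_mul]; exact mul_le_one₀ (hY1 i ω) (abs_nonneg _) (hY1 j ω)
    have hcross : Integrable (fun ω => ∑ l ∈ Finset.range m, Y (s + l) ω * Y (s + m) ω) μ :=
      integrable_finsetSum _ fun l _ => hprod _ _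
    have hsq : Integrable (fun ω => Y (s + m) ω ^ 2) μ := by
      simpa only [sq] using hprod (s + m) (s + m)
    have hsumsq : Integrable (fun ω => (∑ l ∈ Finset.range m, Y (s + l) ω) ^ 2) μ := by
      simp only [sq, Finset.sum_mul_sum]
      exact integrable_finsetSum _ fun l _ => integrable_finsetSum _ fun l' _ => hprod _ _
    have hexp : ∀ ω, (∑ l ∈ Finset.range (m + 1), Y (s + l) ω) ^ 2 =
        (∑ l ∈ Finset.range m, Y (s + l) ω) ^ 2 +
          2 * (∑ l ∈ Finset.range m, Y (s + l) ω * Y (s + m) ω) + Y (s + m) ω ^ 2 := fun ω => by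
      rw [Finset.sum_range_succ, ← Finset.sum_mul]; ring
    have hcr : ∫ ω, ∑ l ∈ Finset.range m, Y (s + l) ω * Y (s + m) ω ∂μ ≤ z * C := by
      rw [integral_finsetSum _ fun l _ => hprod _ _]
      calc _ ≤ ∑ l ∈ Finset.range m, z * c (m - l) := Finset.sum_le_sum fun l hl => by
            have := Finset.mem_range.1 hl
            have h := hcov (s + l) (s + m) (by omega)
            rwa [Nat.add_sub_add_left] at h
        _ = z * ∑ i ∈ Finset.Icc 1 m, c i := by
            rw [← Finset.mul_sum]
            congr 1
            refine Finset.sum_nbij' (m - ·) (m - ·) ?_ ?_ ?_ ?_ ?_ <;>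
              simp only [Finset.mem_range, Finset.mem_Icc] <;> intros <;> first | omega | trivial
        _ ≤ z * C := mul_le_mul_of_nonneg_left (hC m (by omega)) hz
    simp only [hexp]
    have hfirst : Integrable (fun ω => (∑ l ∈ Finset.range m, Y (s + l) ω) ^ 2 +
        2 * ∑ l ∈ Finset.range m, Y (s + l) ω * Y (s + m) ω) μ := hsumsq.add (hcross.const_mul 2)
    rw [integral_add hfirst hsq,
      integral_add hsumsq (hcross.const_mul 2), integral_const_mul]
    have := ih (by omega)
    have := hvar (s + m)
    push_cast
    linarith

lemma integral_exp_mul_le {W : Ω → ℝ} (hW : Measurable W) {b v θ : ℝ} (hb : ∀ ω, |W ω| ≤ b)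
    (hmean : ∫ ω, W ω ∂μ = 0) (hv : ∫ ω, W ω ^ 2 ∂μ ≤ v) (hθ : 0 ≤ θ) (hθb : θ * b ≤ 1) :
    ∫ ω, Real.exp (θ * W ω) ∂μ ≤ Real.exp (θ ^ 2 * v) := by
  have habs : ∀ ω, |θ * W ω| ≤ 1 := fun ω => by
    rw [abs_mul, abs_of_nonneg hθ]
    exact (mul_le_mul_of_nonneg_left (hb ω) hθ).trans hθb
  have hWi : Integrable W μ := integrable_of_abs_le hW hb
  have hW2 : Integrable (fun ω => W ω ^ 2) μ :=
    integrable_of_abs_le (hW.pow_const 2) (c := b ^ 2) fun ω => by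
      rw [abs_pow]; exact pow_le_pow_left₀ (abs_nonneg _) (hb ω) 2
  have hexp : Integrable (fun ω => Real.exp (θ * W ω)) μ :=
    integrable_of_abs_le (hW.const_mul θ).exp (c := Real.exp 1) fun ω => by
      rw [Real.abs_exp]; exact Real.exp_le_exp.2 (abs_le.1 (habs ω)).2
  have hlin : Integrable (fun ω => 1 + θ * W ω) μ := (integrable_const 1).add (hWi.const_mul θ)
  calc ∫ ω, Real.exp (θ * W ω) ∂μ
      ≤ ∫ ω, (1 + θ * W ω + θ ^ 2 * W ω ^ 2) ∂μ := by
        refine integral_mono hexp (hlin.add (hW2.const_mul _)) fun ω => ?_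
        have := (abs_le.1 (Real.abs_exp_sub_one_sub_id_le (habs ω))).2
        simp only
        nlinarith
    _ = θ ^ 2 * ∫ ω, W ω ^ 2 ∂μ + 1 := by
        rw [integral_add hlin (hW2.const_mul _),
          integral_add (integrable_const 1) (hWi.const_mul θ), integral_const_mul,
          integral_const_mul, hmean]
        simp [add_comm]
    _ ≤ θ ^ 2 * v + 1 := by gcongr
    _ ≤ Real.exp (θ ^ 2 * v) := Real.add_one_le_exp _

lemma integral_exp_sum_blockSum_le (hX : ∀ i, Measurable (X i)) {Y : ℕ → Ω → ℝ} {m : ℕ}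
    (hm : 1 ≤ m) {v θ : ℝ}
    (hY : ∀ i, Measurable[MeasurableSpace.comap (X i) inferInstance] (Y i))
    (hY1 : ∀ i ω, |Y i ω| ≤ 1) (hmean : ∀ i, ∫ ω, Y i ω ∂μ = 0)
    (hv : ∀ j, ∫ ω, blockSum Y m j ω ^ 2 ∂μ ≤ v) (hv0 : 0 ≤ v) (hθ : 0 ≤ θ) (hθm : θ * m ≤ 1)
    (d q : ℕ) :
    ∫ ω, Real.exp (θ * ∑ j ∈ Finset.range (q + 1), blockSum Y m (2 * j + d) ω) ∂μ ≤
      Real.exp ((q + 1) * (θ ^ 2 * v) + q * (Real.exp 1 * phiCoef X μ m)) := by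
  have hYm : ∀ i, Measurable (Y i) := fun i => (hY i).mono (hX i).comap_le le_rfl
  have hWm : ∀ j, Measurable (blockSum Y m j) := fun j =>
    (measurable_blockSum hY m j).mono (sigmaGen_le hX _) le_rfl
  have hW0 : ∀ j, ∫ ω, blockSum Y m j ω ∂μ = 0 := fun j => by
    unfold blockSum
    rw [integral_finsetSum _ fun l _ => integrable_of_abs_le (hYm _) (hY1 _)]
    exact Finset.sum_eq_zero fun l _ => hmean _
  have hφ := phiCoef_nonneg (X := X) (μ := μ) m
  simp only [Finset.mul_sum, Real.exp_sum]
  refine (integral_prod_le_phiCoef (c := d * m) (M := Real.exp 1) (a := Real.exp (θ ^ 2 * v))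
    hX hm (fun j => ?_) (fun j ω => (Real.exp_pos _).le) (fun j ω => ?_) (fun j => ?_) q).trans ?_
  · have h := measurable_blockSum hY m (2 * j + d)
    rw [add_mul] at h
    exact Real.measurable_exp.comp (h.const_mul θ)
  · refine Real.exp_le_exp.2 (le_trans ?_ hθm)
    exact mul_le_mul_of_nonneg_left ((le_abs_self _).trans (abs_blockSum_le hY1 m _ ω)) hθ
  · exact integral_exp_mul_le (hWm _) (abs_blockSum_le hY1 m _) (hW0 _) (hv _) hθ hθm
  · have h1 : 1 ≤ Real.exp (θ ^ 2 * v) := Real.one_le_exp (by positivity)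
    have hstep : Real.exp (θ ^ 2 * v) + phiCoef X μ m * Real.exp 1 ≤
        Real.exp (θ ^ 2 * v + Real.exp 1 * phiCoef X μ m) := by
      rw [Real.exp_add]
      have h2 := Real.add_one_le_exp (Real.exp 1 * phiCoef X μ m)
      have h3 : 0 ≤ Real.exp 1 * phiCoef X μ m := by positivity
      nlinarith [mul_le_mul_of_nonneg_left h2 (zero_le_one.trans h1)]
    calc _ ≤ Real.exp (θ ^ 2 * v) *
          Real.exp (θ ^ 2 * v + Real.exp 1 * phiCoef X μ m) ^ q := by gcongr
      _ = _ := by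
        rw [← Real.exp_nat_mul, ← Real.exp_add]
        ring_nf

lemma measureReal_le_sum_le (hX : ∀ i, Measurable (X i)) {Y : ℕ → Ω → ℝ} {m : ℕ}
    (hm : 1 ≤ m) {v t ε : ℝ}
    (hY : ∀ i, Measurable[MeasurableSpace.comap (X i) inferInstance] (Y i))
    (hY1 : ∀ i ω, |Y i ω| ≤ 1) (hmean : ∀ i, ∫ ω, Y i ω ∂μ = 0)
    (hv : ∀ j, ∫ ω, blockSum Y m j ω ^ 2 ∂μ ≤ v) (hv0 : 0 ≤ v) (ht : 0 ≤ t)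
    (htm : 2 * t * m ≤ 1) (q : ℕ) :
    μ.real {ω | ε ≤ ∑ l ∈ Finset.range (2 * (q + 1) * m), Y (1 + l) ω} ≤
      Real.exp (-t * ε + ((q + 1) * ((2 * t) ^ 2 * v) + q * (Real.exp 1 * phiCoef X μ m))) := by
  have hYm : ∀ i, Measurable (Y i) := fun i => (hY i).mono (hX i).comap_le le_rfl
  have hWm : ∀ j, Measurable (blockSum Y m j) := fun j =>
    (measurable_blockSum hY m j).mono (sigmaGen_le hX _) le_rfl
  have hi : ∀ (θ : ℝ) (T : Finset ℕ) (g : ℕ → ℕ), Integrable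
      (fun ω => Real.exp (θ * ∑ j ∈ T, blockSum Y m (g j) ω)) μ := fun θ T g => by
    refine integrable_of_abs_le ((Finset.measurable_fun_sum _ fun j _ => hWm _).const_mul θ).exp
      (c := Real.exp (|θ| * (T.card * m))) fun ω => ?_
    rw [Real.abs_exp]
    refine Real.exp_le_exp.2 ((le_abs_self _).trans ?_)
    rw [abs_mul]
    refine mul_le_mul_of_nonneg_left ?_ (abs_nonneg _)
    exact (Finset.abs_sum_le_sum_abs _ _).trans
      ((Finset.sum_le_sum fun _ _ => abs_blockSum_le hY1 m _ ω).trans_eq (by simp))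
  have hiS : Integrable
      (fun ω => Real.exp (t * ∑ l ∈ Finset.range (2 * (q + 1) * m), Y (1 + l) ω)) μ := by
    refine integrable_of_abs_le ((Finset.measurable_fun_sum _ fun j _ => hYm _).const_mul t).exp
      (c := Real.exp (|t| * (2 * (q + 1) * m : ℕ))) fun ω => ?_
    rw [Real.abs_exp]
    refine Real.exp_le_exp.2 ((le_abs_self _).trans ?_)
    rw [abs_mul]
    refine mul_le_mul_of_nonneg_left ?_ (abs_nonneg _)
    exact (Finset.abs_sum_le_sum_abs _ _).trans
      ((Finset.sum_le_sum fun _ _ => hY1 _ ω).trans_eq (by simp))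
  refine (ProbabilityTheory.measure_ge_le_exp_mul_mgf ε ht hiS).trans ?_
  rw [Real.exp_add]
  refine mul_le_mul_of_nonneg_left ?_ (Real.exp_pos _).le
  have he := integral_exp_sum_blockSum_le (μ := μ) hX hm hY hY1 hmean hv hv0
    (mul_nonneg zero_le_two ht) htm 0 q
  have ho := integral_exp_sum_blockSum_le (μ := μ) hX hm hY hY1 hmean hv hv0
    (mul_nonneg zero_le_two ht) htm 1 q
  have hle : ProbabilityTheory.mgf
        (fun ω => ∑ l ∈ Finset.range (2 * (q + 1) * m), Y (1 + l) ω) μ t ≤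
      ∫ ω, (1 / 2 * Real.exp (2 * t * ∑ j ∈ Finset.range (q + 1), blockSum Y m (2 * j + 0) ω) +
        1 / 2 * Real.exp (2 * t * ∑ j ∈ Finset.range (q + 1), blockSum Y m (2 * j + 1) ω)) ∂μ := by
    refine integral_mono hiS (((hi _ _ _).const_mul _).add ((hi _ _ _).const_mul _)) fun ω => ?_
    simp only [sum_range_eq_blockSum, add_zero]
    set U := ∑ j ∈ Finset.range (q + 1), blockSum Y m (2 * j) ω
    set V := ∑ j ∈ Finset.range (q + 1), blockSum Y m (2 * j + 1) ω
    rw [mul_add, Real.exp_add, mul_assoc, mul_assoc, two_mul (t * U), two_mul (t * V),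
      Real.exp_add, Real.exp_add]
    nlinarith [sq_nonneg (Real.exp (t * U) - Real.exp (t * V))]
  rw [integral_add ((hi _ _ _).const_mul _) ((hi _ _ _).const_mul _), integral_const_mul,
    integral_const_mul] at hle
  linarith

lemma measureReal_lt_abs_sum_le (hX : ∀ i, Measurable (X i)) {Y : ℕ → Ω → ℝ} {m : ℕ}
    (hm : 1 ≤ m) {v t ε : ℝ}
    (hY : ∀ i, Measurable[MeasurableSpace.comap (X i) inferInstance] (Y i))
    (hY1 : ∀ i ω, |Y i ω| ≤ 1) (hmean : ∀ i, ∫ ω, Y i ω ∂μ = 0)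
    (hv : ∀ j, ∫ ω, blockSum Y m j ω ^ 2 ∂μ ≤ v) (hv0 : 0 ≤ v) (ht : 0 ≤ t)
    (htm : 2 * t * m ≤ 1) (q : ℕ) :
    μ.real {ω | ε < |∑ l ∈ Finset.range (2 * (q + 1) * m), Y (1 + l) ω|} ≤
      2 * Real.exp
        (-t * ε + ((q + 1) * ((2 * t) ^ 2 * v) + q * (Real.exp 1 * phiCoef X μ m))) := by
  have hpos := measureReal_le_sum_le (μ := μ) (ε := ε) hX hm hY hY1 hmean hv hv0 ht htm q
  have hneg := measureReal_le_sum_le (μ := μ) (ε := ε) (Y := fun i ω => -Y i ω) hX hm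
    (fun i => (hY i).neg) (by simpa only [abs_neg] using hY1)
    (fun i => by rw [integral_neg, hmean, neg_zero])
    (by simpa only [blockSum, Finset.sum_neg_distrib, neg_sq] using hv) hv0 ht htm q
  refine le_trans (measureReal_mono (fun ω hω => ?_) (measure_ne_top _ _))
    ((measureReal_union_le _ _).trans ((add_le_add hpos hneg).trans_eq (two_mul _).symm))
  rcases lt_abs.1 (mem_ofPred_eq ▸ hω) with h | h
  · exact Or.inl h.le
  · exact Or.inr (by simpa only [mem_ofPred_eq, Finset.sum_neg_distrib] using h.le)

end Mixing

section Indicator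

variable {Ω : Type*} [MeasurableSpace Ω] {μ : Measure Ω} [IsProbabilityMeasure μ]

lemma integral_indicator_sub_mul {A B : Set Ω} (hA : MeasurableSet A) (hB : MeasurableSet B)
    (z : ℝ) :
    ∫ ω, (A.indicator 1 ω - z) * (B.indicator 1 ω - z) ∂μ =
      μ.real (A ∩ B) - z * μ.real A - z * μ.real B + z ^ 2 := by
  have hi : ∀ {S : Set Ω}, MeasurableSet S → Integrable (S.indicator (1 : Ω → ℝ)) μ :=
    fun hS => (integrable_const 1).indicator hS
  have hAB := hi (hA.inter hB)
  have hexp : ∀ ω, (A.indicator 1 ω - z) * (B.indicator 1 ω - z) =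
      (A ∩ B).indicator (1 : Ω → ℝ) ω - z * A.indicator 1 ω - z * B.indicator 1 ω + z ^ 2 :=
    fun ω => by rw [inter_indicator_one, Pi.mul_apply]; ring
  simp only [hexp]
  have h1 : Integrable (fun ω => (A ∩ B).indicator (1 : Ω → ℝ) ω - z * A.indicator 1 ω) μ :=
    hAB.sub ((hi hA).const_mul z)
  have h2 : Integrable (fun ω => (A ∩ B).indicator (1 : Ω → ℝ) ω - z * A.indicator 1 ω -
    z * B.indicator 1 ω) μ := h1.sub ((hi hB).const_mul z)
  rw [integral_add h2 (integrable_const _), integral_sub h1 ((hi hB).const_mul z),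
    integral_sub hAB ((hi hA).const_mul z), integral_const_mul, integral_const_mul,
    integral_indicator_one hA, integral_indicator_one hB, integral_indicator_one (hA.inter hB)]
  simp

end Indicator

/-- The centered indicator of `X i ∈ S`, set to `0` outside `1 ≤ i ≤ n`. -/
noncomputable def centeredIndicator {Ω : Type*} (X : ℕ → Ω → ℝ) (S : Set ℝ) (z : ℝ) (n i : ℕ)
    (ω : Ω) : ℝ :=
  if i ∈ Finset.Icc 1 n then (X i ⁻¹' S).indicator 1 ω - z else 0

section CenteredIndicator

variable {Ω : Type*} {X : ℕ → Ω → ℝ} {S : Set ℝ} {z : ℝ} {n : ℕ}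

lemma measurable_centeredIndicator (hS : MeasurableSet S) (i : ℕ) :
    Measurable[MeasurableSpace.comap (X i) inferInstance] (centeredIndicator X S z n i) := by
  unfold centeredIndicator
  split_ifs
  · have hpre : MeasurableSet[MeasurableSpace.comap (X i) inferInstance] (X i ⁻¹' S) := ⟨S, hS, rfl⟩
    exact (Measurable.indicator measurable_const hpre).sub_const z
  · exact measurable_const

lemma abs_centeredIndicator_le_one (hz0 : 0 ≤ z) (hz1 : z ≤ 1) (i : ℕ) (ω : Ω) :
    |centeredIndicator X S z n i ω| ≤ 1 := by
  unfold centeredIndicator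
  rw [abs_le]
  split_ifs
  · by_cases h : ω ∈ X i ⁻¹' S <;> simp [h] <;> constructor <;> linarith
  · simp

lemma sum_range_centeredIndicator {N : ℕ} (hN : n ≤ N) (ω : Ω) :
    ∑ l ∈ Finset.range N, centeredIndicator X S z n (1 + l) ω =
      ∑ i ∈ Finset.Icc 1 n, ((X i ⁻¹' S).indicator 1 ω - z) := by
  rw [← Finset.sum_subset (Finset.range_subset_range.2 hN) fun l _ hl => ?_]
  · refine Finset.sum_nbij' (1 + ·) (· - 1) ?_ ?_ ?_ ?_ ?_
    all_goals simp only [Finset.mem_range, Finset.mem_Icc]; intros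
    all_goals try omega
    rw [centeredIndicator, if_pos (Finset.mem_Icc.2 (by omega))]
  · rw [Finset.mem_range] at hl
    exact if_neg fun h => by rw [Finset.mem_Icc] at h; omega

variable [MeasurableSpace Ω] {μ : Measure Ω} [IsProbabilityMeasure μ]

lemma integral_centeredIndicator (hX : ∀ i, Measurable (X i)) (hS : MeasurableSet S)
    (hz : ∀ i, 1 ≤ i → μ.real (X i ⁻¹' S) = z) (i : ℕ) :
    ∫ ω, centeredIndicator X S z n i ω ∂μ = 0 := by
  unfold centeredIndicator
  split_ifs with h
  · have hint : Integrable ((X i ⁻¹' S).indicator (1 : Ω → ℝ)) μ :=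
      (integrable_const 1).indicator (hX i hS)
    rw [integral_sub hint (integrable_const z),
      integral_indicator_one (hX i hS), hz i (Finset.mem_Icc.1 h).1]
    simp
  · simp

lemma integral_centeredIndicator_sq_le (hX : ∀ i, Measurable (X i)) (hS : MeasurableSet S)
    (hz0 : 0 ≤ z) (hz : ∀ i, 1 ≤ i → μ.real (X i ⁻¹' S) = z) (i : ℕ) :
    ∫ ω, centeredIndicator X S z n i ω ^ 2 ∂μ ≤ z := by
  unfold centeredIndicator
  split_ifs with h
  · simp only [sq]
    rw [integral_indicator_sub_mul (hX i hS) (hX i hS), inter_self,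
      hz i (Finset.mem_Icc.1 h).1]
    nlinarith
  · simpa using hz0

lemma integral_centeredIndicator_mul_le (hX : ∀ i, Measurable (X i)) (hS : MeasurableSet S)
    (hz0 : 0 ≤ z) (hz : ∀ i, 1 ≤ i → μ.real (X i ⁻¹' S) = z) (i j : ℕ) (hij : i < j) :
    ∫ ω, centeredIndicator X S z n i ω * centeredIndicator X S z n j ω ∂μ ≤
      z * phiCoef X μ (j - i) := by
  have hφ := phiCoef_nonneg (X := X) (μ := μ) (j - i)
  unfold centeredIndicator
  split_ifs with hi hj
  · have hi1 := (Finset.mem_Icc.1 hi).1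
    rw [integral_indicator_sub_mul (hX i hS) (hX j hS), hz i hi1, hz j (by omega)]
    have h := measure_inter_le_phiCoef (X := X) (μ := μ) (k := i) (n := j - i) hi1
      (comap_le_sigmaGen X (by exact ⟨hi1, le_rfl⟩) _ ⟨S, hS, rfl⟩)
      (comap_le_sigmaGen X (i := j) (by simp only [mem_ofPred_eq]; omega) _ ⟨S, hS, rfl⟩)
    have h' := ENNReal.toReal_mono (by finiteness) h
    rw [ENNReal.toReal_mul, ENNReal.toReal_add (by finiteness) (by finiteness),
      ENNReal.toReal_ofReal hφ] at h'
    change μ.real _ ≤ μ.real _ * (μ.real _ + _) at h'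
    rw [hz i hi1, hz j (by omega)] at h'
    linarith
  all_goals simp; positivity

lemma integral_blockSum_centeredIndicator_sq_le (hX : ∀ i, Measurable (X i))
    (hS : MeasurableSet S) (hz0 : 0 ≤ z) (hz1 : z ≤ 1)
    (hz : ∀ i, 1 ≤ i → μ.real (X i ⁻¹' S) = z) (m j : ℕ) :
    ∫ ω, blockSum (centeredIndicator X S z n) m j ω ^ 2 ∂μ ≤
      m * (z * (1 + 4 * ∑ i ∈ Finset.Icc 1 (2 * m), Real.sqrt (phiCoef X μ i))) := by
  have hC : ∀ r ≤ m, ∑ i ∈ Finset.Icc 1 r, phiCoef X μ i ≤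
      ∑ i ∈ Finset.Icc 1 (2 * m), Real.sqrt (phiCoef X μ i) := fun r hr =>
    (Finset.sum_le_sum fun i _ => phiCoef_le_sqrt i).trans <|
      Finset.sum_le_sum_of_subset_of_nonneg (Finset.Icc_subset_Icc le_rfl (by omega))
        fun _ _ _ => Real.sqrt_nonneg _
  refine (integral_sq_sum_le
    (fun i => (measurable_centeredIndicator hS i).mono (hX i).comap_le le_rfl)
    (abs_centeredIndicator_le_one hz0 hz1) hz0 (integral_centeredIndicator_sq_le hX hS hz0 hz)
    (integral_centeredIndicator_mul_le hX hS hz0 hz) hC _ le_rfl).trans ?_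
  have : 0 ≤ ∑ i ∈ Finset.Icc 1 (2 * m), Real.sqrt (phiCoef X μ i) :=
    Finset.sum_nonneg fun _ _ => Real.sqrt_nonneg _
  gcongr
  norm_num

end CenteredIndicator

lemma empDF_sub_empDF {Ω : Type*} (X : ℕ → Ω → ℝ) {n : ℕ} (hn : n ≠ 0) {a b : ℝ} (hab : a ≤ b)
    (c d : ℝ) (ω : Ω) :
    (empDF X n ω b - d) - (empDF X n ω a - c) =
      (n : ℝ)⁻¹ * ∑ i ∈ Finset.Icc 1 n, ((X i ⁻¹' Ioc a b).indicator 1 ω - (d - c)) := by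
  have hi : ∀ i, (X i ⁻¹' Ioc a b).indicator (1 : Ω → ℝ) ω =
      (if X i ω ≤ b then (1 : ℝ) else 0) - (if X i ω ≤ a then (1 : ℝ) else 0) := fun i => by
    by_cases h1 : X i ω ≤ a
    · simp [h1, h1.trans hab, indicator]
    · by_cases h2 : X i ω ≤ b <;> simp [h1, h2, indicator, not_le.1 h1]
  simp only [hi, Finset.sum_sub_distrib, empDF]
  have : (n : ℝ) ≠ 0 := Nat.cast_ne_zero.2 hn
  simp only [Finset.sum_const, Nat.card_Icc, Nat.add_sub_cancel, nsmul_eq_mul]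
  field_simp
  ring

lemma measureReal_preimage_Ioc {Ω : Type*} [MeasurableSpace Ω] {μ : Measure Ω}
    [IsProbabilityMeasure μ] {f : Ω → ℝ} (hf : Measurable f) {a b : ℝ} (hab : a ≤ b) :
    μ.real (f ⁻¹' Ioc a b) = μ.real {ω | f ω ≤ b} - μ.real {ω | f ω ≤ a} := by
  have h : f ⁻¹' Ioc a b = {ω | f ω ≤ b} \ {ω | f ω ≤ a} := by
    ext ω
    simp [and_comm]
  rw [h]
  exact measureReal_sdiff (fun ω (hω : _ ≤ a) => hω.trans hab) (hf measurableSet_Iic)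

lemma exists_block_count {m n : ℕ} (hm : 1 ≤ m) (hmn : m ≤ n) :
    ∃ q : ℕ, n ≤ 2 * (q + 1) * m ∧ (q + 1) * m ≤ n ∧ q * (2 * m) ≤ n := by
  obtain ⟨q, hq⟩ : ∃ q, q = (n - 1) / (2 * m) := ⟨_, rfl⟩
  have hqle : q * (2 * m) ≤ n - 1 := hq ▸ Nat.div_mul_le_self _ _
  have hqgt : n - 1 < q * (2 * m) + 2 * m := hq ▸ Nat.lt_div_mul_add (by omega)
  have h1 : 2 * (q + 1) * m = q * m + q * m + m + m := by ring
  have h2 : (q + 1) * m = q * m + m := by ring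
  have h3 : q * (2 * m) = q * m + q * m := by ring
  refine ⟨q, by omega, ?_, by omega⟩
  rcases Nat.eq_zero_or_pos q with h0 | h0
  · simpa [h0] using hmn
  · have := Nat.le_mul_of_pos_left m h0
    omega

lemma measureReal_empDF_increment_le {Ω : Type*} [MeasurableSpace Ω] {μ : Measure Ω}
    [IsProbabilityMeasure μ] {X : ℕ → Ω → ℝ} (hX : ∀ i, Measurable (X i)) {F : ℝ → ℝ}
    (hF : ∀ i, 1 ≤ i → ∀ x, F x = (μ {ω | X i ω ≤ x}).toReal) {a b : ℝ} (hab : a ≤ b)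
    {γ : ℝ} (hγ : 0 < γ) {β : ℝ} (hβ : 0 < β ∧ β < 1) {n : ℕ} (hn : 1 ≤ n) {m : ℕ}
    (hm : m = ⌊(n : ℝ) ^ β⌋₊) {C2 : ℝ}
    (hC2 : C2 = 4 * (1 + 4 * ∑ i ∈ Finset.Icc 1 (2 * m), Real.sqrt (phiCoef X μ i))) :
    μ.real {ω | γ < |(empDF X n ω b - F b) - (empDF X n ω a - F a)|} ≤
      2 * Real.exp (Real.exp 1 * (n : ℝ) ^ (1 - β) * phiCoef X μ m) *
        Real.exp (-(n * γ ^ 2) / (2 * C2 * (2 * (F b - F a) + (n : ℝ) ^ β * γ))) := by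
  set z := F b - F a with hz
  set D := 1 + 4 * ∑ i ∈ Finset.Icc 1 (2 * m), Real.sqrt (phiCoef X μ i)
  set P := (n : ℝ) ^ β
  have hn0 : (0 : ℝ) < n := Nat.cast_pos.2 hn
  have hn1 : (1 : ℝ) ≤ n := Nat.one_le_cast.2 hn
  have hzS : ∀ i, 1 ≤ i → μ.real (X i ⁻¹' Ioc a b) = z := fun i hi => by
    rw [measureReal_preimage_Ioc (hX i) hab, hz, hF i hi a, hF i hi b]
    rfl
  have hz0 : 0 ≤ z := hzS 1 le_rfl ▸ measureReal_nonneg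
  have hz1 : z ≤ 1 := hzS 1 le_rfl ▸ measureReal_le_one
  have hD1 : 1 ≤ D := by
    have : 0 ≤ ∑ i ∈ Finset.Icc 1 (2 * m), Real.sqrt (phiCoef X μ i) :=
      Finset.sum_nonneg fun _ _ => Real.sqrt_nonneg _
    linarith
  have hP1 : 1 ≤ P := Real.one_le_rpow hn1 hβ.1.le
  have hPn : P ≤ n := by
    simpa using Real.rpow_le_rpow_of_exponent_le hn1 hβ.2.le
  have hm1 : 1 ≤ m := by rw [hm]; exact Nat.le_floor (by simpa using hP1)
  have hmP : (m : ℝ) ≤ P := by rw [hm]; exact Nat.floor_le (by positivity)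
  have hPm : P ≤ 2 * m := by
    have h1 : P < m + 1 := by rw [hm]; exact Nat.lt_floor_add_one P
    have h2 : (1 : ℝ) ≤ m := Nat.one_le_cast.2 hm1
    linarith
  have hmn : m ≤ n := Nat.cast_le.1 (hmP.trans hPn)
  obtain ⟨q, hqgt, hqm, hqle⟩ := exists_block_count hm1 hmn
  have hqP : (q : ℝ) ≤ (n : ℝ) ^ (1 - β) := by
    rw [Real.rpow_sub hn0, Real.rpow_one, le_div_iff₀ (by positivity)]
    calc (q : ℝ) * P ≤ q * (2 * m) := by gcongr
      _ ≤ n := by exact_mod_cast hqle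
  set R := 2 * z + P * γ with hR
  have hR0 : 0 < R := by positivity
  have hC4 : C2 = 4 * D := hC2
  have hC0 : 0 < C2 := by linarith
  set t := γ / (C2 * R) with ht
  have ht0 : 0 ≤ t := by positivity
  have htm : 2 * t * m ≤ 1 := by
    rw [ht, mul_div_assoc', div_mul_eq_mul_div, div_le_one (by positivity)]
    have h1 : γ * m ≤ R := by nlinarith
    have h2 : 2 * R ≤ C2 * R := mul_le_mul_of_nonneg_right (by linarith) hR0.le
    linarith
  have hφ := phiCoef_nonneg (X := X) (μ := μ) m
  have hmain := measureReal_lt_abs_sum_le (μ := μ) (Y := centeredIndicator X (Ioc a b) z n)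
    (v := m * (z * D)) (ε := n * γ) hX hm1
    (fun i => measurable_centeredIndicator measurableSet_Ioc i)
    (abs_centeredIndicator_le_one hz0 hz1)
    (integral_centeredIndicator hX measurableSet_Ioc hzS)
    (integral_blockSum_centeredIndicator_sq_le hX measurableSet_Ioc hz0 hz1 hzS m)
    (mul_nonneg m.cast_nonneg (mul_nonneg hz0 (zero_le_one.trans hD1))) ht0 htm q
  have hset : {ω | γ < |(empDF X n ω b - F b) - (empDF X n ω a - F a)|} =
      {ω | n * γ < |∑ l ∈ Finset.range (2 * (q + 1) * m),
        centeredIndicator X (Ioc a b) z n (1 + l) ω|} := by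
    ext ω
    rw [mem_ofPred_eq, mem_ofPred_eq, sum_range_centeredIndicator hqgt,
      empDF_sub_empDF X (by omega) hab, abs_mul, abs_of_pos (inv_pos.2 hn0),
      lt_inv_mul_iff₀ hn0]
  rw [hset]
  refine hmain.trans ?_
  rw [mul_assoc, ← Real.exp_add]
  refine mul_le_mul_of_nonneg_left (Real.exp_le_exp.2 ?_) zero_le_two
  have hmix : q * (Real.exp 1 * phiCoef X μ m) ≤
      Real.exp 1 * (n : ℝ) ^ (1 - β) * phiCoef X μ m := by
    calc _ ≤ (n : ℝ) ^ (1 - β) * (Real.exp 1 * phiCoef X μ m) := by gcongr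
      _ = _ := by ring
  have hvar : ((q : ℝ) + 1) * ((2 * t) ^ 2 * (m * (z * D))) ≤ n * (t ^ 2 * (C2 * z)) := by
    have h : ((q : ℝ) + 1) * m ≤ n := by exact_mod_cast hqm
    calc _ = ((q : ℝ) + 1) * m * (t ^ 2 * (C2 * z)) := by rw [hC4]; ring
      _ ≤ _ := by gcongr
  have hopt : -t * (n * γ) + n * (t ^ 2 * (C2 * z)) ≤ -(n * γ ^ 2) / (2 * C2 * R) := by
    have h1 : z ≤ R / 2 := by rw [hR]; nlinarith
    calc _ ≤ -t * (n * γ) + n * (t ^ 2 * (C2 * (R / 2))) := by gcongr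
      _ = _ := by rw [ht]; field_simp; ring
  linarith

/-- **Centered increment bound.** For a φ-mixing sequence with common marginal
distribution function `F` satisfying `F(ξ_p) = p`, fixing `y ∈ ℝ` and setting
`z = |F(y) - F(ξ_p)|`, for any `γ > 0`, any `0 < β < 1` with `m = ⌊n^β⌋`, and any
`n ≥ 2`,
`P(|(F_n(y) - F(y)) - (F_n(ξ_p) - p)| > γ) ≤ 2e C₁ exp{-n γ² / (2 C₂ (2z + n^β γ))}`,
where `C₁ = exp{2e n^{1-β} φ(m)}` and `C₂ = 4[1 + 4 ∑_{i=1}^{2m} φ^{1/2}(i)]`. -/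
theorem bahadur_increment_bound {Ω : Type*} [MeasurableSpace Ω] (μ : Measure Ω)
    [IsProbabilityMeasure μ]
    (X : ℕ → Ω → ℝ) (hX : ∀ i, Measurable (X i))
    (hanti : Antitone (phiCoef X μ))
    (hmix : Tendsto (phiCoef X μ) atTop (nhds 0))
    (F : ℝ → ℝ) (hF : ∀ i, 1 ≤ i → ∀ x, F x = (μ {ω | X i ω ≤ x}).toReal)
    (p : ℝ) (hp : 0 < p ∧ p < 1) (hFξ : F (quantile F p) = p)
    (y : ℝ) (z : ℝ) (hz : z = |F y - F (quantile F p)|)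
    (γ : ℝ) (hγ : 0 < γ)
    (β : ℝ) (hβ : 0 < β ∧ β < 1)
    (n : ℕ) (hn : 2 ≤ n)
    (m : ℕ) (hm : m = ⌊(n : ℝ) ^ β⌋₊)
    (C1 : ℝ) (hC1 : C1 = Real.exp (2 * Real.exp 1 * (n : ℝ) ^ (1 - β) * phiCoef X μ m))
    (C2 : ℝ) (hC2 : C2 = 4 * (1 + 4 * ∑ i ∈ Finset.Icc 1 (2 * m), Real.sqrt (phiCoef X μ i))) :
    (μ {ω | γ < |(empDF X n ω y - F y) - (empDF X n ω (quantile F p) - p)|}).toReal ≤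
      2 * Real.exp 1 * C1 *
        Real.exp (-(n * γ ^ 2) / (2 * C2 * (2 * z + (n : ℝ) ^ β * γ))) := by
  have hbound : ∀ a b : ℝ, a ≤ b →
      μ.real {ω | γ < |(empDF X n ω b - F b) - (empDF X n ω a - F a)|} ≤
        2 * Real.exp 1 * C1 *
          Real.exp (-(n * γ ^ 2) / (2 * C2 * (2 * (F b - F a) + (n : ℝ) ^ β * γ))) := by
    intro a b hab
    refine (measureReal_empDF_increment_le hX hF hab hγ hβ (by omega) hm hC2).trans ?_
    have hφ := phiCoef_nonneg (X := X) (μ := μ) m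
    refine mul_le_mul_of_nonneg_right ?_ (Real.exp_pos _).le
    rw [hC1, mul_assoc 2 (Real.exp 1), ← Real.exp_add]
    refine mul_le_mul_of_nonneg_left ?_ zero_le_two
    refine Real.exp_le_exp.2 ?_
    have : 0 ≤ Real.exp 1 * (n : ℝ) ^ (1 - β) * phiCoef X μ m := by positivity
    linarith
  have hmono : Monotone F := fun a b hab => by
    rw [hF 1 le_rfl a, hF 1 le_rfl b]
    exact measureReal_mono (fun ω (hω : _ ≤ a) => hω.trans hab) (measure_ne_top _ _)
  rw [hz]
  change μ.real _ ≤ _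
  rcases le_total y (quantile F p) with h | h
  · have := hbound _ _ h
    rw [abs_sub_comm (F y), abs_of_nonneg (sub_nonneg.2 (hmono h))]
    simpa only [hFξ, abs_sub_comm (empDF X n _ y - F y) (empDF X n _ (quantile F p) - p)] using this
  · have := hbound _ _ h
    rw [abs_of_nonneg (sub_nonneg.2 (hmono h))]
    simpa only [hFξ] using this
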